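/- arXiv:1711.02912 — 3 statements merged into one kernel-verified Lean document; each statement's English description precedes it below -/
import Mathlib

section
/- (Theorem 1, stability preservation under Galerkin projection.) Let E ∈ ℝ^{n×n} be symmetric positive definite and A ∈ ℝ^{n×n} be dissipative (A + Aᵀ negative definite). Let V ∈ ℝ^{n×r} have full column rank r. Then the reduced mass matrix Ē = Vᵀ E V is symmetric positive definite (in particular invertible), and the matrix Ē⁻¹ (Vᵀ A V) is a stable matrix, i.e. all its eigenvalues have strictly negative real part. -/
open Matrix

theorem Matrix.mulVec_injective_of_rank_eq_card {K m n : Type*} [Field K] [Fintype m] [Fintype n]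
    {V : Matrix m n K} (hV : V.rank = Fintype.card n) :
    Function.Injective V.mulVec := by
  classical
  rw [Matrix.mulVec_injective_iff, linearIndependent_iff_card_eq_finrank_span, ← hV,
    Matrix.rank_eq_finrank_span_cols]
  rfl

theorem Matrix.re_map_ofReal_mulVec {m n : Type*} [Fintype n] (M : Matrix m n ℝ)
    (z : n → ℂ) : (fun i => ((M.map (algebraMap ℝ ℂ) *ᵥ z) i).re) = M *ᵥ fun i => (z i).re := by
  ext i
  simp [Matrix.mulVec, dotProduct]

theorem Matrix.im_map_ofReal_mulVec {m n : Type*} [Fintype n] (M : Matrix m n ℝ)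
    (z : n → ℂ) : (fun i => ((M.map (algebraMap ℝ ℂ) *ᵥ z) i).im) = M *ᵥ fun i => (z i).im := by
  ext i
  simp [Matrix.mulVec, dotProduct]

theorem Matrix.dotProduct_mulVec_neg_of_dissipative {n : Type*} [Fintype n] {B : Matrix n n ℝ}
    (hB : (-(B + Bᵀ)).PosDef) {x : n → ℝ} (hx : x ≠ 0) : x ⬝ᵥ B *ᵥ x < 0 := by
  have h := hB.dotProduct_mulVec_pos hx
  have hT : x ⬝ᵥ Bᵀ *ᵥ x = x ⬝ᵥ B *ᵥ x := by
    rw [Matrix.mulVec_transpose, dotProduct_comm, Matrix.dotProduct_mulVec]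
  rw [star_trivial, Matrix.neg_mulVec, dotProduct_neg, Matrix.add_mulVec, dotProduct_add, hT] at h
  linarith

theorem Matrix.re_neg_of_mem_spectrum_inv_mul {n : Type*} [Fintype n] [DecidableEq n]
    {P B : Matrix n n ℝ} (hP : P.PosDef) (hB : (-(B + Bᵀ)).PosDef) {μ : ℂ}
    (hμ : μ ∈ spectrum ℂ ((P⁻¹ * B).map (algebraMap ℝ ℂ))) : μ.re < 0 := by
  rw [← Matrix.spectrum_toLin', ← Module.End.hasEigenvalue_iff_mem_spectrum] at hμ
  obtain ⟨z, hz⟩ := hμ.exists_hasEigenvector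
  have hev : (P⁻¹ * B).map (algebraMap ℝ ℂ) *ᵥ z = μ • z := by
    simpa using hz.apply_eq_smul
  set x : n → ℝ := fun i => (z i).re with hx
  set y : n → ℝ := fun i => (z i).im with hy
  have hPB : P * (P⁻¹ * B) = B :=
    Matrix.mul_nonsing_inv_cancel_left _ _ ((Matrix.isUnit_iff_isUnit_det _).mp hP.isUnit)
  have hre : (P⁻¹ * B) *ᵥ x = μ.re • x - μ.im • y := by
    rw [← Matrix.re_map_ofReal_mulVec, hev]
    ext i
    simp [hx, hy]
  have him : (P⁻¹ * B) *ᵥ y = μ.re • y + μ.im • x := by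
    rw [← Matrix.im_map_ofReal_mulVec, hev]
    ext i
    simp [hx, hy]
  have hBx : B *ᵥ x = μ.re • P *ᵥ x - μ.im • P *ᵥ y := by
    rw [← hPB, ← Matrix.mulVec_mulVec, hre, Matrix.mulVec_sub, Matrix.mulVec_smul,
      Matrix.mulVec_smul]
  have hBy : B *ᵥ y = μ.re • P *ᵥ y + μ.im • P *ᵥ x := by
    rw [← hPB, ← Matrix.mulVec_mulVec, him, Matrix.mulVec_add, Matrix.mulVec_smul,
      Matrix.mulVec_smul]
  have hsymm : x ⬝ᵥ P *ᵥ y = y ⬝ᵥ P *ᵥ x := by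
    have hT : Pᵀ = P := by simpa using hP.isHermitian.eq
    rw [Matrix.dotProduct_mulVec, ← Matrix.mulVec_transpose, hT, dotProduct_comm]
  have hsum : x ⬝ᵥ B *ᵥ x + y ⬝ᵥ B *ᵥ y = μ.re * (x ⬝ᵥ P *ᵥ x + y ⬝ᵥ P *ᵥ y) := by
    rw [hBx, hBy]
    simp only [dotProduct_sub, dotProduct_add, dotProduct_smul, smul_eq_mul, hsymm]
    ring
  have hPnonneg (v : n → ℝ) : 0 ≤ v ⬝ᵥ P *ᵥ v := by
    simpa using hP.posSemidef.dotProduct_mulVec_nonneg v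
  have hBnonpos (v : n → ℝ) : v ⬝ᵥ B *ᵥ v ≤ 0 := by
    by_cases hv : v = 0
    · simp [hv]
    · exact (Matrix.dotProduct_mulVec_neg_of_dissipative hB hv).le
  have hxy : x ≠ 0 ∨ y ≠ 0 := by
    by_contra! h
    exact hz.2 (funext fun i => Complex.ext (congrFun h.1 i) (congrFun h.2 i))
  have hneg : x ⬝ᵥ B *ᵥ x + y ⬝ᵥ B *ᵥ y < 0 := by
    rcases hxy with h | h
    · exact add_neg_of_neg_of_nonpos (Matrix.dotProduct_mulVec_neg_of_dissipative hB h) (hBnonpos y)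
    · exact add_neg_of_nonpos_of_neg (hBnonpos x) (Matrix.dotProduct_mulVec_neg_of_dissipative hB h)
  rw [hsum] at hneg
  exact neg_of_mul_neg_left hneg (add_nonneg (hPnonneg x) (hPnonneg y))

/-- Theorem 1 (stability preservation under Galerkin projection).
Let `E` be symmetric positive definite, `A` dissipative (i.e. `-(A + Aᵀ)` is
positive definite), and `V` of full column rank `r`. Then the reduced mass matrix
`Ē = Vᵀ E V` is symmetric positive definite (in particular invertible), and
`Ē⁻¹ (Vᵀ A V)` is a stable matrix: all its complex eigenvalues have strictly
negative real part. -/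
theorem galerkin_projection_preserves_stability {n r : ℕ}
    (E A : Matrix (Fin n) (Fin n) ℝ) (V : Matrix (Fin n) (Fin r) ℝ)
    (hE : E.PosDef) (hA : (-(A + Aᵀ)).PosDef) (hV : V.rank = r) :
    (Vᵀ * E * V).PosDef ∧
      ∀ μ ∈ spectrum ℂ (((Vᵀ * E * V)⁻¹ * (Vᵀ * A * V)).map (algebraMap ℝ ℂ)),
        μ.re < 0 := by
  have hinj : Function.Injective V.mulVec :=
    Matrix.mulVec_injective_of_rank_eq_card (by simpa using hV)
  have hP : (Vᵀ * E * V).PosDef := by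
    simpa using hE.conjTranspose_mul_mul_same hinj
  have hB : (-(Vᵀ * A * V + (Vᵀ * A * V)ᵀ)).PosDef := by
    have h := hA.conjTranspose_mul_mul_same hinj
    rw [conjTranspose_eq_transpose_of_trivial] at h
    convert h using 1
    simp only [transpose_mul, transpose_transpose, Matrix.mul_neg, Matrix.neg_mul,
      Matrix.mul_add, Matrix.add_mul, Matrix.mul_assoc]
  exact ⟨hP, fun μ hμ => Matrix.re_neg_of_mem_spectrum_inv_mul hP hB hμ⟩
end

section
/- (Theorem 2, stabilised Galerkin reduction.) Let E, A ∈ ℝ^{n×n} with E invertible, and let M ∈ ℝ^{n×n} be symmetric positive definite satisfying the generalised Lyapunov equation Aᵀ M E + Eᵀ M A + F = 0 for some symmetric positive definite F ∈ ℝ^{n×n}. Let V ∈ ℝ^{n×r} have full column rank. Then the reduced mass matrix Ē = Vᵀ Eᵀ M E V is symmetric positive definite, and Ē⁻¹ (Vᵀ Eᵀ M A V) is a stable matrix. In other words, the Galerkin-type reduction of the transformed system Eᵀ M E ẋ = Eᵀ M A x with projection matrix V is asymptotically stable. -/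
open Matrix

namespace Matrix

open scoped ComplexOrder

variable {n : Type*} [Fintype n]

theorem mulVec_injective_of_rank_eq_card_s6 {m K : Type*} [Field K] {V : Matrix m n K}
    (hV : V.rank = Fintype.card n) : Function.Injective V.mulVec := by
  rw [mulVec_injective_iff, linearIndependent_iff_card_eq_finrank_span, Set.finrank,
    ← rank_eq_finrank_span_cols, hV]

theorem re_star_dotProduct_map_ofReal_mulVec (N : Matrix n n ℝ) (z : n → ℂ) :
    (star z ⬝ᵥ (N.map (algebraMap ℝ ℂ) *ᵥ z)).re =
      (fun i ↦ (z i).re) ⬝ᵥ (N *ᵥ fun i ↦ (z i).re) +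
        (fun i ↦ (z i).im) ⬝ᵥ (N *ᵥ fun i ↦ (z i).im) := by
  simp [dotProduct, mulVec, Finset.sum_add_distrib]

theorem PosDef.map_ofReal {N : Matrix n n ℝ} (hN : N.PosDef) :
    (N.map (algebraMap ℝ ℂ)).PosDef := by
  have hherm : (N.map (algebraMap ℝ ℂ)).IsHermitian :=
    hN.isHermitian.map _ fun x ↦ by simp
  refine .of_dotProduct_mulVec_pos hherm fun z hz ↦ ?_
  refine Complex.pos_iff.mpr ⟨?_, (hherm.im_star_dotProduct_mulVec_self z).symm⟩
  rw [re_star_dotProduct_map_ofReal_mulVec]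
  have nonneg (u : n → ℝ) : 0 ≤ u ⬝ᵥ (N *ᵥ u) := by
    simpa using hN.posSemidef.dotProduct_mulVec_nonneg u
  have pos {u : n → ℝ} (hu : u ≠ 0) : 0 < u ⬝ᵥ (N *ᵥ u) := by
    simpa using hN.dotProduct_mulVec_pos hu
  by_cases hre : (fun i ↦ (z i).re) = 0
  · refine add_pos_of_nonneg_of_pos (nonneg _) (pos fun him ↦ hz ?_)
    ext i
    exact Complex.ext (congrFun hre i) (congrFun him i)
  · exact add_pos_of_pos_of_nonneg (pos hre) (nonneg _)

/-- If `P` and `-(K + Kᴴ)` are positive definite, then every eigenvalue of `P⁻¹ * K` lies in the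
open left half-plane. -/
theorem PosDef.re_lt_zero_of_mem_spectrum_inv_mul [DecidableEq n] {P K Q : Matrix n n ℂ}
    (hP : P.PosDef) (hQ : Q.PosDef) (hK : Kᴴ + K + Q = 0) {μ : ℂ}
    (hμ : μ ∈ spectrum ℂ (P⁻¹ * K)) : μ.re < 0 := by
  rw [← spectrum_toLin', ← Module.End.hasEigenvalue_iff_mem_spectrum] at hμ
  obtain ⟨z, hz⟩ := hμ.exists_hasEigenvector
  have heig : K *ᵥ z = μ • (P *ᵥ z) := by
    have h := hz.apply_eq_smul
    rw [toLin'_apply] at h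
    rw [← mulVec_smul, ← h, mulVec_mulVec,
      mul_nonsing_inv_cancel_left _ _ ((isUnit_iff_isUnit_det _).mp hP.isUnit)]
  have hp := Complex.pos_iff.mp (hP.dotProduct_mulVec_pos hz.2)
  have hq := Complex.pos_iff.mp (hQ.dotProduct_mulVec_pos hz.2)
  have hadj : star z ⬝ᵥ (Kᴴ *ᵥ z) = star (star z ⬝ᵥ (K *ᵥ z)) := by
    rw [star_dotProduct, star_mulVec, conjTranspose_conjTranspose, dotProduct_mulVec]
  have hsum : star z ⬝ᵥ ((Kᴴ + K + Q) *ᵥ z) = 0 := by simp [hK]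
  rw [add_mulVec, add_mulVec, dotProduct_add, dotProduct_add, hadj, heig, dotProduct_smul] at hsum
  have hre := congrArg Complex.re hsum
  simp only [smul_eq_mul, Complex.add_re, RCLike.star_def, Complex.conj_re, Complex.mul_re,
    ← hp.2, mul_zero, sub_zero, Complex.zero_re] at hre
  nlinarith [hp.1, hq.1]

end Matrix

/-- Theorem 2 (stabilised Galerkin reduction). Let `E` be invertible and `M`
symmetric positive definite satisfying the generalised Lyapunov equation
`Aᵀ M E + Eᵀ M A + F = 0` for some symmetric positive definite `F`. Let `V` have
full column rank. Then the reduced mass matrix `Ē = Vᵀ Eᵀ M E V` is symmetric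
positive definite, and `Ē⁻¹ (Vᵀ Eᵀ M A V)` is a stable matrix, i.e. the
Galerkin-type reduction of the transformed system `Eᵀ M E ẋ = Eᵀ M A x` with
projection matrix `V` is asymptotically stable. -/
theorem stabilised_galerkin_reduction_stable {n r : ℕ}
    (E A M F : Matrix (Fin n) (Fin n) ℝ) (V : Matrix (Fin n) (Fin r) ℝ)
    (hE : IsUnit E.det) (hM : M.PosDef) (hF : F.PosDef)
    (hlyap : Aᵀ * M * E + Eᵀ * M * A + F = 0) (hV : V.rank = r) :
    (Vᵀ * Eᵀ * M * E * V).PosDef ∧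
      ∀ μ ∈ spectrum ℂ
        (((Vᵀ * Eᵀ * M * E * V)⁻¹ * (Vᵀ * Eᵀ * M * A * V)).map (algebraMap ℝ ℂ)),
        μ.re < 0 := by
  have hVinj : Function.Injective V.mulVec := mulVec_injective_of_rank_eq_card_s6 (by simpa using hV)
  have hEV : Function.Injective (E * V).mulVec := by
    have h := (mulVec_injective_of_isUnit ((isUnit_iff_isUnit_det E).mpr hE)).comp hVinj
    simpa [Function.comp_def, Function.Injective, mulVec_mulVec] using h
  have hP : (Vᵀ * Eᵀ * M * E * V).PosDef := by
    simpa [Matrix.mul_assoc] using hM.conjTranspose_mul_mul_same hEV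
  refine ⟨hP, fun μ hμ ↦ ?_⟩
  have hQ : (Vᵀ * F * V).PosDef := by
    simpa using hF.conjTranspose_mul_mul_same hVinj
  have hMt : Mᵀ = M := by simpa using hM.isHermitian.eq
  have hreal : (Vᵀ * Eᵀ * M * A * V)ᵀ + Vᵀ * Eᵀ * M * A * V + Vᵀ * F * V = 0 := by
    have h := congrArg (fun X ↦ Vᵀ * X * V) hlyap
    simpa [Matrix.mul_add, Matrix.add_mul, Matrix.mul_assoc, hMt] using h
  have hinv : (Vᵀ * Eᵀ * M * E * V)⁻¹.map (algebraMap ℝ ℂ) =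
      ((Vᵀ * Eᵀ * M * E * V).map (algebraMap ℝ ℂ))⁻¹ := by
    refine (inv_eq_left_inv ?_).symm
    rw [← Matrix.map_mul, nonsing_inv_mul _ ((isUnit_iff_isUnit_det _).mp hP.isUnit)]
    simp
  rw [Matrix.map_mul, hinv] at hμ
  refine hP.map_ofReal.re_lt_zero_of_mem_spectrum_inv_mul hQ.map_ofReal ?_ hμ
  have hc := congrArg (fun X ↦ X.map (algebraMap ℝ ℂ)) hreal
  rw [← conjTranspose_map _ fun x ↦ by simp, conjTranspose_eq_transpose_of_trivial]
  simpa only [Matrix.map_add _ (map_add (algebraMap ℝ ℂ)),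
    Matrix.map_zero _ (map_zero (algebraMap ℝ ℂ))] using hc
end

section
/- (Theorem 4, matrix square root formula.) Let Z ∈ ℝ^{n×q} with rank(Z) = q ≤ n, let Z = Q R be a QR factorisation with Q ∈ ℝ^{n×n} orthogonal and R = [R'; 0], R' ∈ ℝ^{q×q} upper triangular, and let R' R'ᵀ = S D Sᵀ be an orthogonal eigendecomposition with S ∈ ℝ^{q×q} orthogonal and D diagonal with positive entries. Define S̃ = diag(S, I_{n−q}) and D̃^{1/2} = diag((I_q + D)^{1/2}, I_{n−q}), where (I_q + D)^{1/2} is the diagonal matrix of square roots of the diagonal entries of I_q + D. Then the symmetric matrix X = Q S̃ D̃^{1/2} S̃ᵀ Qᵀ satisfies X² = I_n + Z Zᵀ, i.e. X is a matrix square root of M̃ = I_n + Z Zᵀ, and X is positive definite. -/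
open Matrix

/-- Conjugating a matrix with a symmetric square root by an orthogonal matrix. -/
theorem Matrix.conj_orthogonal_mul_self {n : Type*} [Fintype n] [DecidableEq n]
    {U : Matrix n n ℝ} (hU : Uᵀ * U = 1) (E : Matrix n n ℝ) :
    (U * E * Uᵀ) * (U * E * Uᵀ) = U * (E * E) * Uᵀ :=
  calc (U * E * Uᵀ) * (U * E * Uᵀ) = U * E * (Uᵀ * U) * E * Uᵀ := by
        simp only [Matrix.mul_assoc]
    _ = U * (E * E) * Uᵀ := by rw [hU, Matrix.mul_one]; simp only [Matrix.mul_assoc]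

/-- A diagonal matrix with positive entries stays positive definite under orthogonal
conjugation. -/
theorem Matrix.posDef_conj_orthogonal_diagonal {n : Type*} [Fintype n] [DecidableEq n]
    {U : Matrix n n ℝ} (hU : Uᵀ * U = 1) {e : n → ℝ} (he : ∀ i, 0 < e i) :
    (U * Matrix.diagonal e * Uᵀ).PosDef := by
  have hU' : IsUnit U := IsUnit.of_mul_eq_one Uᵀ (mul_eq_one_comm.mp hU)
  have h := (Matrix.IsUnit.posDef_star_right_conjugate_iff hU').mpr (Matrix.PosDef.diagonal he)
  rwa [Matrix.star_eq_conjTranspose, Matrix.conjTranspose_eq_transpose_of_trivial] at h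

/-- Theorem 4 (matrix square root formula). Let `Z` be a real `n × q` matrix of
full column rank `q` (rows indexed by `Fin q ⊕ Fin m`, so `n = q + m`), let
`Z = Q R` be a QR factorisation with `Q` orthogonal and `R = [R'; 0]` with `R'`
upper triangular, and let `R' R'ᵀ = S D Sᵀ` be an orthogonal eigendecomposition
with `S` orthogonal and `D = diagonal d` with positive entries. With
`S̃ = diag(S, I)` and `D̃^{1/2} = diag((I + D)^{1/2}, I)`, the symmetric matrix
`X = Q S̃ D̃^{1/2} S̃ᵀ Qᵀ` satisfies `X² = I + Z Zᵀ`, i.e. `X` is a matrix square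
root of `M̃ = I + Z Zᵀ`, and `X` is positive definite. -/
theorem matrix_square_root_formula {q m : ℕ}
    (Z : Matrix (Fin q ⊕ Fin m) (Fin q) ℝ)
    (Q : Matrix (Fin q ⊕ Fin m) (Fin q ⊕ Fin m) ℝ)
    (R' S : Matrix (Fin q) (Fin q) ℝ) (d : Fin q → ℝ)
    (hrank : Z.rank = q)
    (hQ : Qᵀ * Q = 1)
    (hR' : R'.BlockTriangular id)
    (hQR : Z = Q * Matrix.fromRows R' (0 : Matrix (Fin m) (Fin q) ℝ))
    (hS : Sᵀ * S = 1)
    (hd : ∀ j, 0 < d j)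
    (hdecomp : R' * R'ᵀ = S * Matrix.diagonal d * Sᵀ) :
    let Stilde := Matrix.fromBlocks S 0 0 (1 : Matrix (Fin m) (Fin m) ℝ)
    let Dhalf := Matrix.fromBlocks
      (Matrix.diagonal fun j => Real.sqrt (1 + d j)) 0 0
      (1 : Matrix (Fin m) (Fin m) ℝ)
    let X := Q * Stilde * Dhalf * Stildeᵀ * Qᵀ
    Xᵀ = X ∧ X * X = 1 + Z * Zᵀ ∧ X.PosDef := by
  intro Stilde Dhalf X
  have hStilde : Stildeᵀ * Stilde = 1 := by
    simp [Stilde, Matrix.fromBlocks_transpose, Matrix.fromBlocks_multiply, hS]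
  have hU : (Q * Stilde)ᵀ * (Q * Stilde) = 1 := by
    rw [Matrix.transpose_mul, Matrix.mul_assoc, ← Matrix.mul_assoc Qᵀ, hQ, Matrix.one_mul,
      hStilde]
  have hDhalf : Dhalf = Matrix.diagonal (Sum.elim (fun j => Real.sqrt (1 + d j)) 1) := by
    rw [← Matrix.fromBlocks_diagonal, Matrix.diagonal_one']
  have hX : X = (Q * Stilde) * Dhalf * (Q * Stilde)ᵀ := by
    simp only [X, Matrix.transpose_mul, Matrix.mul_assoc]
  have hsq : Dhalf * Dhalf = 1 + Matrix.fromBlocks (Matrix.diagonal d) 0 0 0 := by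
    have h : ∀ j, Real.sqrt (1 + d j) * Real.sqrt (1 + d j) = 1 + d j := fun j =>
      Real.mul_self_sqrt (by linarith [hd j])
    have hD : Matrix.diagonal (fun j => 1 + d j) = 1 + Matrix.diagonal d := by
      rw [← Matrix.diagonal_one, Matrix.diagonal_add]
    simp only [Dhalf, Matrix.fromBlocks_multiply, Matrix.diagonal_mul_diagonal, h, hD,
      ← Matrix.fromBlocks_one, Matrix.fromBlocks_add, Matrix.mul_zero, Matrix.zero_mul,
      Matrix.mul_one, add_zero, zero_add]
  have hZ : Z * Zᵀ =
      (Q * Stilde) * Matrix.fromBlocks (Matrix.diagonal d) 0 0 0 * (Q * Stilde)ᵀ := by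
    have h : Matrix.fromRows R' (0 : Matrix (Fin m) (Fin q) ℝ) *
        (Matrix.fromRows R' (0 : Matrix (Fin m) (Fin q) ℝ))ᵀ =
        Stilde * Matrix.fromBlocks (Matrix.diagonal d) 0 0 0 * Stildeᵀ := by
      rw [Matrix.transpose_fromRows, Matrix.fromRows_mul_fromCols, hdecomp]
      simp [Stilde, Matrix.fromBlocks_transpose, Matrix.fromBlocks_multiply]
    calc Z * Zᵀ = Q * (Matrix.fromRows R' (0 : Matrix (Fin m) (Fin q) ℝ) *
          (Matrix.fromRows R' (0 : Matrix (Fin m) (Fin q) ℝ))ᵀ) * Qᵀ := by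
          rw [hQR, Matrix.transpose_mul]; simp only [Matrix.mul_assoc]
      _ = _ := by rw [h, Matrix.transpose_mul]; simp only [Matrix.mul_assoc]
  have hpos : X.PosDef := by
    rw [hX, hDhalf]
    refine Matrix.posDef_conj_orthogonal_diagonal hU ?_
    rintro (j | j)
    · exact Real.sqrt_pos.mpr (by linarith [hd j])
    · exact one_pos
  refine ⟨?_, ?_, hpos⟩
  · rw [← Matrix.conjTranspose_eq_transpose_of_trivial]
    exact hpos.isHermitian
  · rw [hX, Matrix.conj_orthogonal_mul_self hU, hsq, Matrix.mul_add, Matrix.add_mul,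
      Matrix.mul_one, mul_eq_one_comm.mp hU, hZ]
end
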